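/- arXiv:2208.12570 — 4 statements merged into one kernel-verified Lean document; each statement's English description precedes it below -/
import Mathlib

section
/- The infimum defining the depth-Q interpretable value is attained and can be computed by finite enumeration: the infimum over all depth-Q univariate tree rules (i, b) and solutions x^1, …, x^{2^Q} ∈ X of Σ_{j∈[N]} c_j · x^{ℓ(j)} equals the minimum taken only over split dimensions i ∈ [n]^Q, thresholds b with b_q ∈ B_{i_q} for each q ∈ [Q], and solutions x^1, …, x^{2^Q} ∈ X; in particular this infimum is a minimum. -/
/-- The leaf assigned to scenario `j` by a depth-`Q` univariate tree rule with split
dimensions `i` and thresholds `b`: `ℓ(j) = 1 + Σ_{q∈[Q]} 2^{q−1}·𝟙[c_{j,i_q} > b_q]`. -/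
noncomputable def treeLeaf {n N Q : ℕ} (c : Fin N → Fin n → ℝ) (i : Fin Q → Fin n)
    (b : Fin Q → ℝ) (j : Fin N) : ℕ :=
  1 + ∑ q : Fin Q, (if b q < c j (i q) then 2 ^ (q : ℕ) else 0)

/-- The candidate threshold set for dimension `i`:
`B_i = { (c_{ji} + c_{li})/2 : j, l ∈ [N] } ∪ { min_{j∈[N]} c_{ji} − 1 }`. -/
noncomputable def candThresholds {n N : ℕ} (hN : 1 ≤ N) (c : Fin N → Fin n → ℝ)
    (i : Fin n) : Set ℝ :=
  {x | ∃ j l : Fin N, x = (c j i + c l i) / 2} ∪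
    {Finset.univ.inf' ⟨⟨0, hN⟩, Finset.mem_univ _⟩ (fun j => c j i) - 1}

/-- The set of objective values achievable by depth-`Q` univariate tree rules `(i, b)` and
solutions `x^1, …, x^{2^Q} ∈ X`; its infimum is the depth-`Q` interpretable value. -/
def interpValues (n N Q : ℕ) (c : Fin N → Fin n → ℝ) (X : Finset (Fin n → ℝ)) : Set ℝ :=
  {v | ∃ (i : Fin Q → Fin n) (b : Fin Q → ℝ) (x : ℕ → Fin n → ℝ),
    (∀ k ∈ Finset.Icc 1 (2 ^ Q), x k ∈ X) ∧
    v = ∑ j : Fin N, ∑ t : Fin n, c j t * x (treeLeaf c i b j) t}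

/-- The set of objective values achievable when additionally every threshold `b_q` is
restricted to the finite candidate set `B_{i_q}`. -/
def interpValuesCand (n N Q : ℕ) (hN : 1 ≤ N) (c : Fin N → Fin n → ℝ)
    (X : Finset (Fin n → ℝ)) : Set ℝ :=
  {v | ∃ (i : Fin Q → Fin n) (b : Fin Q → ℝ) (x : ℕ → Fin n → ℝ),
    (∀ q : Fin Q, b q ∈ candThresholds hN c (i q)) ∧
    (∀ k ∈ Finset.Icc 1 (2 ^ Q), x k ∈ X) ∧
    v = ∑ j : Fin N, ∑ t : Fin n, c j t * x (treeLeaf c i b j) t}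

theorem treeLeaf_mem_Icc {n N Q : ℕ} (c : Fin N → Fin n → ℝ) (i : Fin Q → Fin n)
    (b : Fin Q → ℝ) (j : Fin N) : treeLeaf c i b j ∈ Finset.Icc 1 (2 ^ Q) := by
  have hle : ∑ q : Fin Q, (if b q < c j (i q) then 2 ^ (q : ℕ) else 0)
      ≤ ∑ q : Fin Q, 2 ^ (q : ℕ) :=
    Finset.sum_le_sum fun q _ => by split_ifs <;> simp
  have hlt : ∑ q : Fin Q, 2 ^ (q : ℕ) < 2 ^ Q := by
    rw [Fin.sum_univ_eq_sum_range (fun q => 2 ^ q)]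
    exact Nat.geomSum_lt le_rfl fun q hq => Finset.mem_range.mp hq
  rw [Finset.mem_Icc, treeLeaf]
  omega

/-- Every threshold splits the scenarios in the same way as some candidate threshold. -/
theorem exists_candThreshold_lt_iff {n N : ℕ} (hN : 1 ≤ N) (c : Fin N → Fin n → ℝ)
    (i : Fin n) (b : ℝ) :
    ∃ b' ∈ candThresholds hN c i, ∀ j, b' < c j i ↔ b < c j i := by
  by_cases h : ∃ j, c j i ≤ b
  · obtain ⟨j₀, hj₀⟩ := h
    obtain ⟨m, hm, hmax⟩ := (Finset.univ.filter fun j => c j i ≤ b).exists_max_image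
      (fun j => c j i) ⟨j₀, by simpa using hj₀⟩
    simp only [Finset.mem_filter, Finset.mem_univ, true_and] at hm hmax
    refine ⟨c m i, Or.inl ⟨m, m, by ring⟩, fun j => ⟨fun hj => ?_, fun hj => hm.trans_lt hj⟩⟩
    by_contra hb
    exact hj.not_ge (hmax j (not_lt.mp hb))
  · push Not at h
    refine ⟨_, Or.inr rfl, fun j => iff_of_true ?_ (h j)⟩
    exact (sub_one_lt _).trans_le (Finset.inf'_le (fun j => c j i) (Finset.mem_univ j))

theorem interpValues_eq_interpValuesCand {n N : ℕ} (Q : ℕ) (hN : 1 ≤ N)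
    (c : Fin N → Fin n → ℝ) (X : Finset (Fin n → ℝ)) :
    interpValues n N Q c X = interpValuesCand n N Q hN c X := by
  ext v
  constructor
  · rintro ⟨i, b, x, hx, rfl⟩
    choose b' hmem hiff using fun q => exists_candThreshold_lt_iff hN c (i q) (b q)
    exact ⟨i, b', x, hmem, hx, by simp only [treeLeaf, hiff]⟩
  · rintro ⟨i, b, x, -, hx, rfl⟩
    exact ⟨i, b, x, hx, rfl⟩

theorem finite_interpValues (n N Q : ℕ) (c : Fin N → Fin n → ℝ) (X : Finset (Fin n → ℝ)) :
    (interpValues n N Q c X).Finite := by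
  refine (Set.finite_range fun y : Fin N → X =>
    ∑ j : Fin N, ∑ t : Fin n, c j t * (y j : Fin n → ℝ) t).subset ?_
  rintro _ ⟨i, b, x, hx, rfl⟩
  exact ⟨fun j => ⟨x (treeLeaf c i b j), hx _ (treeLeaf_mem_Icc c i b j)⟩, rfl⟩

theorem interpValues_nonempty {n : ℕ} (N Q : ℕ) (hn : 1 ≤ n) (c : Fin N → Fin n → ℝ)
    {X : Finset (Fin n → ℝ)} (hX : X.Nonempty) : (interpValues n N Q c X).Nonempty := by
  obtain ⟨x, hx⟩ := hX
  exact ⟨_, fun _ => ⟨0, hn⟩, fun _ => 0, fun _ => x, fun _ _ => hx, rfl⟩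

/-- The infimum defining the depth-`Q` interpretable value is attained and
can be computed by finite enumeration: it equals the minimum taken only over split
dimensions `i ∈ [n]^Q`, thresholds `b` with `b_q ∈ B_{i_q}`, and solutions in `X`; in
particular this infimum is a minimum. -/
theorem interp_value_attained_by_enumeration (n N Q : ℕ) (hn : 1 ≤ n) (hN : 1 ≤ N)
    (hQ : 1 ≤ Q) (c : Fin N → Fin n → ℝ) (X : Finset (Fin n → ℝ)) (hX : X.Nonempty) :
    sInf (interpValues n N Q c X) = sInf (interpValuesCand n N Q hN c X) ∧
      sInf (interpValuesCand n N Q hN c X) ∈ interpValuesCand n N Q hN c X ∧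
      sInf (interpValues n N Q c X) ∈ interpValues n N Q c X := by
  have hmem := (interpValues_nonempty N Q hn c hX).csInf_mem (finite_interpValues n N Q c X)
  rw [← interpValues_eq_interpValuesCand]
  exact ⟨rfl, hmem, hmem⟩
end

section
/- The number of distinct scenario-to-leaf assignments induced by depth-Q univariate tree rules is at most (n·(N+1))^Q: the set of maps ℓ : [N] → [2^Q] of the form ℓ(j) = 1 + Σ_{q∈[Q]} 2^{q−1}·𝟙[c_{j,i_q} > b_q] for some split dimensions i_1, …, i_Q ∈ [n] and thresholds b_1, …, b_Q ∈ ℝ has cardinality at most (n·(N+1))^Q. -/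
/-- The superlevel sets of a real function on `Fin N` form a chain, so there are at most `N + 1`
of them, one for each cardinality. -/
theorem exists_superlevel_enumeration {N : ℕ} (x : Fin N → ℝ) :
    ∃ g : Fin (N + 1) → Finset (Fin N), ∀ b : ℝ, ∃ k, g k = Finset.univ.filter fun j => b < x j := by
  classical
  have h_inj (b b' : ℝ) (h : (Finset.univ.filter fun j => b < x j).card =
      (Finset.univ.filter fun j => b' < x j).card) :
      (Finset.univ.filter fun j => b < x j) = Finset.univ.filter fun j => b' < x j := by
    rcases le_total b b' with hb | hb
    · exact (Finset.eq_of_subset_of_card_le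
        (Finset.monotone_filter_right _ fun j _ hj => hb.trans_lt hj) h.le).symm
    · exact Finset.eq_of_subset_of_card_le
        (Finset.monotone_filter_right _ fun j _ hj => hb.trans_lt hj) h.ge
  refine ⟨fun k => if h : ∃ b : ℝ, (Finset.univ.filter fun j => b < x j).card = k then
    Finset.univ.filter fun j => h.choose < x j else ∅, fun b => ?_⟩
  have h_card : (Finset.univ.filter fun j => b < x j).card < N + 1 :=
    Nat.lt_succ_of_le ((Finset.card_le_univ _).trans_eq (Fintype.card_fin N))
  have h : ∃ b' : ℝ, (Finset.univ.filter fun j => b' < x j).card =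
      (Finset.univ.filter fun j => b < x j).card := ⟨b, rfl⟩
  exact ⟨⟨_, h_card⟩, (dif_pos h).trans (h_inj _ _ h.choose_spec)⟩

/-- The number of distinct scenario-to-leaf assignments induced by depth-`Q`
univariate tree rules is at most `(n·(N+1))^Q`: the set of maps
`ℓ(j) = 1 + Σ_{q∈[Q]} 2^{q−1}·𝟙[c_{j,i_q} > b_q]` (over all split dimensions `i` and
thresholds `b`) is finite and has cardinality at most `(n·(N+1))^Q`. -/
theorem leaf_maps_card_le (n N Q : ℕ) (hn : 1 ≤ n) (hN : 1 ≤ N)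
    (c : Fin N → Fin n → ℝ) :
    {ℓ : Fin N → ℕ | ∃ (i : Fin Q → Fin n) (b : Fin Q → ℝ),
        ℓ = fun j => treeLeaf c i b j}.Finite ∧
      {ℓ : Fin N → ℕ | ∃ (i : Fin Q → Fin n) (b : Fin Q → ℝ),
        ℓ = fun j => treeLeaf c i b j}.ncard ≤ (n * (N + 1)) ^ Q := by
  classical
  choose g hg using fun d : Fin n => exists_superlevel_enumeration fun j => c j d
  let F : (Fin Q → Fin n × Fin (N + 1)) → Fin N → ℕ := fun p j =>
    1 + ∑ q : Fin Q, (if j ∈ g (p q).1 (p q).2 then 2 ^ (q : ℕ) else 0)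
  have h_sub : {ℓ : Fin N → ℕ | ∃ (i : Fin Q → Fin n) (b : Fin Q → ℝ),
      ℓ = fun j => treeLeaf c i b j} ⊆ Set.range F := by
    rintro _ ⟨i, b, rfl⟩
    choose k hk using fun q => hg (i q) (b q)
    refine ⟨fun q => (i q, k q), ?_⟩
    funext j
    simp [F, treeLeaf, hk]
  refine ⟨(Set.finite_range F).subset h_sub, ?_⟩
  calc _ ≤ (Set.range F).ncard := Set.ncard_le_ncard h_sub (Set.finite_range F)
    _ ≤ Nat.card (Fin Q → Fin n × Fin (N + 1)) := by
      rw [← Set.image_univ, ← Set.ncard_univ]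
      exact Set.ncard_image_le Set.finite_univ
    _ = (n * (N + 1)) ^ Q := by simp
end

section
/- The greedy heuristic is optimal for depth Q = 1: the depth-1 interpretable value equals the minimum over dimensions i ∈ [n] and candidate thresholds b ∈ B_i of [ min_{x∈X} ( Σ_{j∈[N] : c_{ji} ≤ b} c_j ) · x + min_{x∈X} ( Σ_{j∈[N] : c_{ji} > b} c_j ) · x ]. -/
/-- The finite candidate threshold set for dimension `i`:
`B_i = { (c_{ji} + c_{li})/2 : j, l ∈ [N] } ∪ { min_{j∈[N]} c_{ji} − 1 }`. -/
noncomputable def candThresholdsFinset {n N : ℕ} (hN : 1 ≤ N) (c : Fin N → Fin n → ℝ)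
    (i : Fin n) : Finset ℝ :=
  insert (Finset.univ.inf' ⟨⟨0, hN⟩, Finset.mem_univ _⟩ (fun j => c j i) - 1)
    ((Finset.univ ×ˢ Finset.univ).image
      fun p : Fin N × Fin N => (c p.1 i + c p.2 i) / 2)

/-- The cost of a depth-one rule splits into the costs incurred at its two leaves. -/
theorem sum_ite_leaf_eq {n N : ℕ} (c : Fin N → Fin n → ℝ) (i : Fin n) (b : ℝ)
    (x y : Fin n → ℝ) :
    ∑ j : Fin N, ∑ t : Fin n, c j t * (if c j i ≤ b then x t else y t) =
      ∑ t : Fin n, (∑ j ∈ Finset.univ.filter (fun j : Fin N => c j i ≤ b), c j t) * x t +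
        ∑ t : Fin n, (∑ j ∈ Finset.univ.filter (fun j : Fin N => b < c j i), c j t) * y t := by
  rw [Finset.sum_comm, ← Finset.sum_add_distrib]
  refine Finset.sum_congr rfl fun t _ => ?_
  rw [Finset.sum_mul, Finset.sum_mul, Finset.sum_filter, Finset.sum_filter,
    ← Finset.sum_add_distrib]
  refine Finset.sum_congr rfl fun j _ => ?_
  by_cases h : c j i ≤ b
  · simp [h, not_lt.mpr h]
  · simp [h, not_le.mp h]

/-- Every threshold induces the same partition of the scenarios as some candidate threshold. -/
theorem exists_candThreshold_le_iff {n N : ℕ} (hN : 1 ≤ N) (c : Fin N → Fin n → ℝ)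
    (i : Fin n) (b : ℝ) :
    ∃ b' ∈ candThresholdsFinset hN c i, ∀ j, c j i ≤ b' ↔ c j i ≤ b := by
  by_cases h : (Finset.univ.filter fun j : Fin N => c j i ≤ b).Nonempty
  · obtain ⟨k, hk, hmax⟩ := Finset.exists_max_image _ (fun j => c j i) h
    refine ⟨c k i, Finset.mem_insert_of_mem (Finset.mem_image.mpr ⟨(k, k), by simp, by simp⟩),
      fun j => ⟨fun hj => hj.trans (Finset.mem_filter.mp hk).2, fun hj => hmax j (by simpa)⟩⟩
  · refine ⟨_, Finset.mem_insert_self _ _, fun j => iff_of_false (fun hj => ?_)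
      fun hj => h ⟨j, by simpa⟩⟩
    have := Finset.inf'_le (fun j => c j i) (Finset.mem_univ j)
    linarith

/-- The greedy heuristic is optimal for depth `Q = 1`: the depth-1
interpretable value (infimum over split dimensions `i ∈ [n]`, thresholds `b ∈ ℝ` and
solutions `x^1, x^2 ∈ X`, where scenario `j` uses `x^1` if `c_{ji} ≤ b` and `x^2`
otherwise) equals
`min_{i∈[n]} min_{b ∈ B_i} [ min_{x∈X} (Σ_{j : c_{ji} ≤ b} c_j)·x + min_{x∈X} (Σ_{j : c_{ji} > b} c_j)·x ]`. -/
theorem greedy_optimal_depth_one (n N : ℕ) (hn : 1 ≤ n) (hN : 1 ≤ N)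
    (c : Fin N → Fin n → ℝ) (X : Finset (Fin n → ℝ)) (hX : X.Nonempty) :
    sInf {v : ℝ | ∃ (i : Fin n) (b : ℝ) (x1 x2 : Fin n → ℝ), x1 ∈ X ∧ x2 ∈ X ∧
        v = ∑ j : Fin N, ∑ t : Fin n, c j t * (if c j i ≤ b then x1 t else x2 t)} =
      Finset.univ.inf' ⟨⟨0, hn⟩, Finset.mem_univ _⟩ (fun i : Fin n =>
        (candThresholdsFinset hN c i).inf' (Finset.insert_nonempty _ _) (fun b =>
          X.inf' hX (fun x => ∑ t : Fin n,
            (∑ j ∈ Finset.univ.filter (fun j : Fin N => c j i ≤ b), c j t) * x t) +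
          X.inf' hX (fun x => ∑ t : Fin n,
            (∑ j ∈ Finset.univ.filter (fun j : Fin N => b < c j i), c j t) * x t))) := by
  refine IsLeast.csInf_eq ⟨?_, ?_⟩
  · obtain ⟨i, -, hi⟩ := Finset.exists_mem_eq_inf' (s := Finset.univ) ⟨⟨0, hn⟩, Finset.mem_univ _⟩
      (fun i : Fin n =>
        (candThresholdsFinset hN c i).inf' (Finset.insert_nonempty _ _) (fun b =>
          X.inf' hX (fun x => ∑ t : Fin n,
            (∑ j ∈ Finset.univ.filter (fun j : Fin N => c j i ≤ b), c j t) * x t) +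
          X.inf' hX (fun x => ∑ t : Fin n,
            (∑ j ∈ Finset.univ.filter (fun j : Fin N => b < c j i), c j t) * x t)))
    obtain ⟨b, -, hb⟩ := Finset.exists_mem_eq_inf' (s := candThresholdsFinset hN c i)
      (Finset.insert_nonempty _ _) (fun b =>
          X.inf' hX (fun x => ∑ t : Fin n,
            (∑ j ∈ Finset.univ.filter (fun j : Fin N => c j i ≤ b), c j t) * x t) +
          X.inf' hX (fun x => ∑ t : Fin n,
            (∑ j ∈ Finset.univ.filter (fun j : Fin N => b < c j i), c j t) * x t))
    obtain ⟨x, hx, hxe⟩ := Finset.exists_mem_eq_inf' hX (fun x => ∑ t : Fin n,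
      (∑ j ∈ Finset.univ.filter (fun j : Fin N => c j i ≤ b), c j t) * x t)
    obtain ⟨y, hy, hye⟩ := Finset.exists_mem_eq_inf' hX (fun x => ∑ t : Fin n,
      (∑ j ∈ Finset.univ.filter (fun j : Fin N => b < c j i), c j t) * x t)
    refine ⟨i, b, x, y, hx, hy, ?_⟩
    rw [sum_ite_leaf_eq, hi, hb, hxe, hye]
  · rintro _ ⟨i, b, x, y, hx, hy, rfl⟩
    obtain ⟨b', hb', hiff⟩ := exists_candThreshold_le_iff hN c i b
    simp only [← hiff]
    rw [sum_ite_leaf_eq]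
    exact (Finset.inf'_le _ (Finset.mem_univ i)).trans <| (Finset.inf'_le _ hb').trans <|
      add_le_add (Finset.inf'_le _ hx) (Finset.inf'_le _ hy)
end

section
/- The mixed-integer constraints correctly and uniquely encode the traversal of the decision tree: fix Q ≥ 1, split dimensions i_1, …, i_Q ∈ [n], thresholds b_1, …, b_Q ∈ ℝ, and a scenario j with cost vector c_j ∈ ℝ^n. Let s_q = 𝟙[c_{j,i_q} > b_q] and ℓ(j) = 1 + Σ_{q∈[Q]} s_q·2^{q−1}. Suppose ε > 0 satisfies ε ≤ c_{j,i_q} − b_q for every q with c_{j,i_q} > b_q, and M > max_{q∈[Q]} |c_{j,i_q} − b_q| + ε. Then a vector (a^1, …, a^{2^Q}) ∈ {0,1}^{2^Q} with Σ_{k∈[2^Q]} a^k = 1 satisfies both constraints c_{j,i_q} ≤ b_q + M·Σ_{k∈S_q} a^k and b_q + ε − M·(1 − Σ_{k∈S_q} a^k) ≤ c_{j,i_q} for all q ∈ [Q], if and only if a^k = 𝟙[k = ℓ(j)] for all k ∈ [2^Q]. -/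
/-- The number with binary digits `f` is the sum of the powers of two at its nonzero digits. -/
theorem Nat.ofBits_eq_sum {n : ℕ} (f : Fin n → Bool) :
    Nat.ofBits f = ∑ q : Fin n, if f q then 2 ^ (q : ℕ) else 0 := by
  induction n with
  | zero => simp
  | succ n ih =>
    rw [Nat.ofBits_succ, ih, Fin.sum_univ_succ, Finset.mul_sum, add_comm]
    congr 1
    · cases f 0 <;> simp
    · refine Finset.sum_congr rfl fun q _ => ?_
      simp [pow_succ, mul_comm]

/-- A number below `2 ^ n` is determined by its first `n` binary digits. -/
theorem Nat.eq_sum_two_pow_iff_testBit {n k : ℕ} (hk : k < 2 ^ n) (p : Fin n → Prop)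
    [DecidablePred p] :
    k = ∑ q : Fin n, (if p q then 2 ^ (q : ℕ) else 0) ↔
      ∀ q : Fin n, k.testBit q = true ↔ p q := by
  have hsum : ∑ q : Fin n, (if p q then 2 ^ (q : ℕ) else 0) =
      Nat.ofBits fun q => decide (p q) := by
    simp [Nat.ofBits_eq_sum]
  rw [hsum]
  constructor
  · rintro rfl q
    simp [Nat.testBit_ofBits_lt]
  · intro h
    refine Nat.eq_of_testBit_eq fun m => ?_
    by_cases hm : m < n
    · rw [Nat.testBit_ofBits_lt _ _ hm, Bool.eq_iff_iff, h ⟨m, hm⟩]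
      simp
    · have hmn : n ≤ m := not_lt.mp hm
      rw [Nat.testBit_ofBits_ge _ _ hmn]
      exact Nat.testBit_lt_two_pow (hk.trans_le (Nat.pow_le_pow_right two_pos hmn))

/-- A `0`-`1` vector with entries summing to one is the indicator of a single index. -/
theorem exists_eq_ite_of_sum_eq_one {ι : Type*} [Fintype ι] [DecidableEq ι] (a : ι → ℝ)
    (ha : ∀ k, a k = 0 ∨ a k = 1) (hsum : ∑ k, a k = 1) :
    ∃ k₀, ∀ k, a k = if k = k₀ then 1 else 0 := by
  have hnonneg : ∀ k, 0 ≤ a k := fun k => by rcases ha k with h | h <;> simp [h]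
  obtain ⟨k₀, -, hk₀⟩ := Finset.exists_ne_zero_of_sum_ne_zero (hsum.trans_ne one_ne_zero)
  have hone : a k₀ = 1 := (ha k₀).resolve_left hk₀
  refine ⟨k₀, fun k => ?_⟩
  split_ifs with hk
  · rw [hk, hone]
  · have hle : a k + a k₀ ≤ 1 := by
      rw [← hsum, ← Finset.sum_pair hk]
      exact Finset.sum_le_sum_of_subset_of_nonneg (Finset.subset_univ _) fun j _ _ => hnonneg j
    linarith [hnonneg k]

/-- The two big-`M` constraints force a binary indicator `t` to record whether `x < c`. -/
theorem bigM_constraints_iff {c x ε M : ℝ} (hε : 0 < ε) (hsmall : x < c → ε ≤ c - x)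
    (hM : |c - x| + ε < M) (t : Prop) [Decidable t] :
    (c ≤ x + M * (if t then 1 else 0) ∧ x + ε - M * (1 - if t then 1 else 0) ≤ c) ↔
      (t ↔ x < c) := by
  have hpos := le_abs_self (c - x)
  have hneg := neg_abs_le (c - x)
  by_cases ht : t
  · simp only [ht, if_true, true_iff]
    constructor
    · rintro ⟨-, h⟩
      linarith
    · intro h
      have := hsmall h
      constructor <;> linarith
  · simp only [ht, if_false, false_iff, not_lt]
    constructor
    · rintro ⟨h, -⟩
      linarith
    · intro h
      constructor <;> linarith


/-- The mixed-integer constraints correctly and uniquely encode the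
traversal of the decision tree. Fix `Q ≥ 1`, split dimensions `i_q ∈ [n]`, thresholds
`b_q ∈ ℝ` and a scenario with cost vector `cv ∈ ℝ^n`. Let
`ℓ = 1 + Σ_q 2^{q−1}·𝟙[cv_{i_q} > b_q]` be the leaf reached, and suppose `ε > 0` with
`ε ≤ cv_{i_q} − b_q` whenever `cv_{i_q} > b_q`, and `M > max_q |cv_{i_q} − b_q| + ε`.
Then a binary vector `a ∈ {0,1}^{2^Q}` with `Σ_k a^k = 1` satisfies
`cv_{i_q} ≤ b_q + M·Σ_{k∈S_q} a^k` and `b_q + ε − M·(1 − Σ_{k∈S_q} a^k) ≤ cv_{i_q}` for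
all `q` if and only if `a^k = 𝟙[k = ℓ]` for all leaves `k` (leaf `k ∈ [2^Q]` is indexed
here by `k − 1 ∈ Fin (2^Q)`, and `S_q` contains the leaves whose `q`-th binary digit of
`k − 1` is `1`). -/
theorem mip_constraints_encode_traversal (n Q : ℕ) (hn : 1 ≤ n) (hQ : 1 ≤ Q)
    (i : Fin Q → Fin n) (b : Fin Q → ℝ) (cv : Fin n → ℝ)
    (ε M : ℝ) (hε : 0 < ε)
    (hεsmall : ∀ q : Fin Q, b q < cv (i q) → ε ≤ cv (i q) - b q)
    (hM : (Finset.univ : Finset (Fin Q)).sup' ⟨⟨0, hQ⟩, Finset.mem_univ _⟩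
        (fun q => |cv (i q) - b q|) + ε < M)
    (a : Fin (2 ^ Q) → ℝ) (ha : ∀ k : Fin (2 ^ Q), a k = 0 ∨ a k = 1)
    (hsum : ∑ k : Fin (2 ^ Q), a k = 1) :
    ((∀ q : Fin Q, cv (i q) ≤ b q +
        M * ∑ k ∈ Finset.univ.filter (fun k : Fin (2 ^ Q) => (k : ℕ).testBit (q : ℕ)), a k) ∧
      (∀ q : Fin Q, b q + ε -
        M * (1 - ∑ k ∈ Finset.univ.filter
            (fun k : Fin (2 ^ Q) => (k : ℕ).testBit (q : ℕ)), a k) ≤ cv (i q))) ↔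
    (∀ k : Fin (2 ^ Q),
      a k = if (k : ℕ) + 1 =
          1 + ∑ q : Fin Q, (if b q < cv (i q) then 2 ^ (q : ℕ) else 0)
        then 1 else 0) := by
  obtain ⟨k₀, hk₀⟩ := exists_eq_ite_of_sum_eq_one a ha hsum
  have hbit : ∀ q : Fin Q,
      ∑ k ∈ Finset.univ.filter (fun k : Fin (2 ^ Q) => (k : ℕ).testBit (q : ℕ)), a k =
        if (k₀ : ℕ).testBit (q : ℕ) then 1 else 0 := by
    intro q
    simp [hk₀]
  have hMq : ∀ q : Fin Q, |cv (i q) - b q| + ε < M := fun q =>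
    (add_le_add_left (Finset.le_sup' (fun q => |cv (i q) - b q|) (Finset.mem_univ q)) ε).trans_lt hM
  rw [← forall_and]
  simp only [hbit, bigM_constraints_iff hε (hεsmall _) (hMq _)]
  rw [← Nat.eq_sum_two_pow_iff_testBit k₀.isLt fun q => b q < cv (i q)]
  simp only [add_comm 1, add_left_inj]
  constructor
  · intro h k
    rw [hk₀ k, ← h]
    simp only [Fin.ext_iff]
  · intro h
    by_contra hne
    have := h k₀
    rw [hk₀ k₀, if_pos rfl, if_neg hne] at this
    exact one_ne_zero this
end
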